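/- arXiv:2006.11856 — 9 statements merged into one kernel-verified Lean document; each statement's English description precedes it below -/
import Mathlib

section
/- Let G be a rooted acyclic digraph on N vertices, let T > 0, and let r = (0,…,0) be the zero partition vector. Then: (i) no infinite execution of the PCO network over (G, T, r) consists exclusively of jump steps; and (ii) every complete execution synchronizes within time T: there exists an index K with t_K ≤ T such that x_k ∈ A_s for all k ≥ K. -/
/-- A flow step of the PCO network: time strictly advances and every phase
increases at rate `1/T`. -/
def FlowStep {N : ℕ} (T : ℝ) (t : ℕ → ℝ) (x : ℕ → Fin N → ℝ) (k : ℕ) : Prop :=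
  t k < t (k + 1) ∧ ∀ i, x (k + 1) i = x k i + (t (k + 1) - t k) / T

/-- A jump step of the PCO network at step `k` with firing agent `i`. -/
def JumpStepAt {N : ℕ} (E : Fin N → Fin N → Prop) (r : Fin N → ℝ)
    (t : ℕ → ℝ) (x : ℕ → Fin N → ℝ) (k : ℕ) (i : Fin N) : Prop :=
  t (k + 1) = t k ∧ x k i = 1 ∧ x (k + 1) i = 0 ∧
  ∀ j, j ≠ i →
    (E i j →
      (x k j < r j → x (k + 1) j = 0) ∧
      (r j < x k j → x (k + 1) j = 1) ∧
      (x k j = r j → x (k + 1) j = 0 ∨ x (k + 1) j = 1)) ∧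
    (¬ E i j → x (k + 1) j = x k j)

/-- A jump step of the PCO network: some agent with phase `1` fires. -/
def JumpStep {N : ℕ} (E : Fin N → Fin N → Prop) (r : Fin N → ℝ)
    (t : ℕ → ℝ) (x : ℕ → Fin N → ℝ) (k : ℕ) : Prop :=
  ∃ i, JumpStepAt E r t x k i

/-- `(t, x)` is an execution of the PCO network over digraph `E`, period `T`,
partition vector `r`. -/
def IsExecution {N : ℕ} (E : Fin N → Fin N → Prop) (T : ℝ) (r : Fin N → ℝ)
    (t : ℕ → ℝ) (x : ℕ → Fin N → ℝ) : Prop :=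
  t 0 = 0 ∧ (∀ k i, x k i ∈ Set.Icc (0 : ℝ) 1) ∧
  ∀ k, FlowStep T t x k ∨ JumpStep E r t x k

/-- An execution is complete if `sup_k t_k = ∞`. -/
def Complete (t : ℕ → ℝ) : Prop := ∀ M : ℝ, ∃ k, M < t k

/-- The synchronization set `A_s`: all phases equal, or all phases in `{0,1}`. -/
def SyncSet {N : ℕ} (x : Fin N → ℝ) : Prop :=
  (∀ i j, x i = x j) ∨ (∀ i, x i = 0 ∨ x i = 1)

/-- `i` is a root of the digraph `E`: every vertex is reachable from `i`. -/
def IsRoot {V : Type*} (E : V → V → Prop) (i : V) : Prop :=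
  ∀ j, Relation.ReflTransGen E i j

/-- The digraph `E` is acyclic: no edge lies on a directed cycle, i.e. there is
no nonempty directed walk from a vertex back to itself. -/
def Acyclic {V : Type*} (E : V → V → Prop) : Prop :=
  ∀ i j, E i j → ¬ Relation.ReflTransGen E j i

/-- `m` is the number of edges of some directed path of `E`. -/
def IsPathLength {N : ℕ} (E : Fin N → Fin N → Prop) (m : ℕ) : Prop :=
  ∃ p : Fin (m + 1) → Fin N, Function.Injective p ∧
    ∀ k : Fin m, E (p k.castSucc) (p k.succ)

section Execution

variable {N : ℕ} {E : Fin N → Fin N → Prop} {T : ℝ} {t : ℕ → ℝ} {x : ℕ → Fin N → ℝ}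

/-- The out-neighbours of a firing agent are sent to `{0,1}`. -/
theorem JumpStepAt.zero_or_one_of_edge {r : Fin N → ℝ} {k : ℕ} {i j : Fin N}
    (h : JumpStepAt E r t x k i) (hE : E i j) :
    x (k + 1) j = 0 ∨ x (k + 1) j = 1 := by
  obtain ⟨-, -, h0, hstep⟩ := h
  by_cases hji : j = i
  · subst hji; exact Or.inl h0
  · obtain ⟨hlt, hgt, heq⟩ := (hstep j hji).1 hE
    rcases lt_trichotomy (x k j) (r j) with h | h | h
    exacts [Or.inl (hlt h), heq h, Or.inr (hgt h)]

/-- Phases in `{0,1}` stay in `{0,1}` under a jump step. -/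
theorem JumpStepAt.zero_or_one {r : Fin N → ℝ} {k : ℕ} {i j : Fin N}
    (h : JumpStepAt E r t x k i) (hj : x k j = 0 ∨ x k j = 1) :
    x (k + 1) j = 0 ∨ x (k + 1) j = 1 := by
  by_cases hE : E i j
  · exact h.zero_or_one_of_edge hE
  · by_cases hji : j = i
    · subst hji; exact Or.inl h.2.2.1
    · rwa [(h.2.2.2 j hji).2 hE]

theorem IsExecution.monotone {r : Fin N → ℝ} (h : IsExecution E T r t x) : Monotone t := by
  refine monotone_nat_of_le_succ fun k => ?_
  rcases h.2.2 k with hf | ⟨i, hi⟩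
  · exact hf.1.le
  · exact hi.1.ge

/-- Time strictly advances only through flow steps. -/
theorem IsExecution.flowStep_of_lt {r : Fin N → ℝ} (h : IsExecution E T r t x) {k : ℕ}
    (hk : t k < t (k + 1)) : FlowStep T t x k := by
  rcases h.2.2 k with hf | ⟨i, hi⟩
  · exact hf
  · exact absurd hi.1 hk.ne'

/-- At the start of a flow step every phase is below `1`. -/
theorem IsExecution.lt_one_of_flowStep {r : Fin N → ℝ} (h : IsExecution E T r t x) (hT : 0 < T)
    {k : ℕ} (hk : FlowStep T t x k) (i : Fin N) : x k i < 1 := by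
  have h1 := (h.2.1 (k + 1) i).2
  have h2 : 0 < (t (k + 1) - t k) / T := div_pos (sub_pos.2 hk.1) hT
  linarith [hk.2 i]

/-- In a complete execution, every time `s ≥ 0` has a last index whose time is at most `s`. -/
theorem IsExecution.exists_last_le {r : Fin N → ℝ} (h : IsExecution E T r t x)
    (hc : Complete t) {s : ℝ} (hs : 0 ≤ s) : ∃ k, t k ≤ s ∧ s < t (k + 1) := by
  classical
  have hex : ∃ k, s < t k := hc s
  have hspec := Nat.find_spec hex
  have hpos : Nat.find hex ≠ 0 := fun h0 => by
    rw [h0, h.1] at hspec; linarith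
  obtain ⟨k, hk⟩ := Nat.exists_eq_succ_of_ne_zero hpos
  exact ⟨k, not_lt.1 (Nat.find_min hex (by omega)), by rwa [hk] at hspec⟩

/-- Membership in `A_s` is preserved along executions. -/
theorem IsExecution.syncSet_succ {r : Fin N → ℝ} (h : IsExecution E T r t x) (hT : 0 < T)
    {k : ℕ} (hk : SyncSet (x k)) : SyncSet (x (k + 1)) := by
  rcases h.2.2 k with hf | ⟨i, hi⟩
  · have hlt := h.lt_one_of_flowStep hT hf
    have heq : ∀ i j, x k i = x k j := by
      rcases hk with hk | hk
      · exact hk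
      · have h0 : ∀ i, x k i = 0 := fun i => (hk i).resolve_right (hlt i).ne
        intro i j; rw [h0, h0]
    exact Or.inl fun i j => by rw [hf.2 i, hf.2 j, heq i j]
  · refine Or.inr fun j => hi.zero_or_one ?_
    rcases hk with hk | hk
    · exact Or.inr ((hk j i).trans hi.2.1)
    · exact hk j

theorem IsExecution.syncSet_of_le {r : Fin N → ℝ} (h : IsExecution E T r t x) (hT : 0 < T)
    {m k : ℕ} (hmk : m ≤ k) (hm : SyncSet (x m)) : SyncSet (x k) := by
  induction k, hmk using Nat.le_induction with
  | base => exact hm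
  | succ k _ ih => exact h.syncSet_succ hT ih

/-- A phase in `{0,1}` stays in `{0,1}` as long as time does not advance. -/
theorem IsExecution.zero_or_one_of_le {r : Fin N → ℝ} (h : IsExecution E T r t x)
    {s m : ℕ} {j : Fin N} (hsm : s ≤ m) (ht : t m = t s) (hj : x s j = 0 ∨ x s j = 1) :
    x m j = 0 ∨ x m j = 1 := by
  induction m, hsm using Nat.le_induction with
  | base => exact hj
  | succ m hsm ih =>
    have h1 := h.monotone hsm
    have h2 := h.monotone m.le_succ
    have hm : t m = t s := by simp only [Nat.succ_eq_add_one] at h2; linarith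
    rcases h.2.2 m with hf | ⟨i, hi⟩
    · linarith [hf.1]
    · exact hi.zero_or_one (ih hm)

/-- With zero partition, an agent at phase `0` at a positive time has just fired at that time. -/
theorem IsExecution.exists_fired_of_eq_zero (h : IsExecution E T (fun _ => 0) t x) (hT : 0 < T)
    {s : ℕ} {j : Fin N} (hs : 0 < t s) (hj : x s j = 0) :
    ∃ k < s, t k = t s ∧ JumpStepAt E (fun _ => 0) t x k j := by
  induction s with
  | zero => rw [h.1] at hs; exact absurd hs (lt_irrefl _)
  | succ s ih =>
    have hnn := (h.2.1 s j).1
    rcases h.2.2 s with hf | ⟨i, hi⟩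
    · have h2 : 0 < (t (s + 1) - t s) / T := div_pos (sub_pos.2 hf.1) hT
      linarith [hf.2 j]
    · by_cases hji : j = i
      · subst hji; exact ⟨s, s.lt_succ_self, hi.1.symm, hi⟩
      · have h0 : x s j = 0 := by
          by_cases hE : E i j
          · by_contra hne
            have := ((hi.2.2.2 j hji).1 hE).2.1 (lt_of_le_of_ne hnn (Ne.symm hne))
            linarith
          · rw [← (hi.2.2.2 j hji).2 hE, hj]
        obtain ⟨k, hk, htk, hfire⟩ := ih (hi.1 ▸ hs) h0
        exact ⟨k, hk.trans s.lt_succ_self, htk.trans hi.1.symm, hfire⟩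

/-- An agent without in-neighbours flows at rate `1/T` as long as it does not fire. -/
theorem IsExecution.eq_add_of_source {r : Fin N → ℝ} (h : IsExecution E T r t x)
    {ρ : Fin N} (hρ : ∀ i, ¬ E i ρ) {m n : ℕ} (hmn : m ≤ n)
    (hno : ∀ k, m ≤ k → k < n → ¬ JumpStepAt E r t x k ρ) :
    x n ρ = x m ρ + (t n - t m) / T := by
  induction n, hmn using Nat.le_induction with
  | base => simp
  | succ n hmn ih =>
    have ih := ih fun k hk hkn => hno k hk (hkn.trans n.lt_succ_self)
    rcases h.2.2 n with hf | ⟨i, hi⟩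
    · rw [hf.2, ih]; ring
    · have hne : ρ ≠ i := by
        rintro rfl; exact hno n hmn n.lt_succ_self hi
      rw [(hi.2.2.2 ρ hne).2 (hρ i), ih, hi.1]

/-- In a complete execution, a source agent fires at some time in `(0, T]`. -/
theorem IsExecution.exists_source_fires {r : Fin N → ℝ} (h : IsExecution E T r t x) (hT : 0 < T)
    (hc : Complete t) {ρ : Fin N} (hρ : ∀ i, ¬ E i ρ) :
    ∃ k, 0 < t k ∧ t k ≤ T ∧ JumpStepAt E r t x k ρ := by
  by_contra! hno
  obtain ⟨m, hm, hm'⟩ := h.exists_last_le hc le_rfl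
  obtain ⟨n, hn, hn'⟩ := h.exists_last_le hc hT.le
  have hmn : m ≤ n + 1 := by
    by_contra! hlt
    linarith [h.monotone hlt.le]
  have heq := h.eq_add_of_source hρ hmn fun k hk hkn hfire => by
    have hne : m ≠ k := by
      rintro rfl
      linarith [hfire.1]
    exact hno k (hm'.trans_le (h.monotone (by omega)))
      ((h.monotone (by omega : k ≤ n)).trans hn) hfire
  have h1 : 1 < (t (n + 1) - t m) / T := by rw [lt_div_iff₀ hT]; linarith
  linarith [(h.2.1 m ρ).1, (h.2.1 (n + 1) ρ).2]

/-- With zero partition, once a root fires at a positive time all agents reach phase `0`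
before time advances. -/
theorem IsExecution.exists_syncSet_of_root_fires (h : IsExecution E T (fun _ => 0) t x)
    (hT : 0 < T) (hc : Complete t) {ρ : Fin N} (hρ : IsRoot E ρ) {k : ℕ} (hk : 0 < t k)
    (hfire : JumpStepAt E (fun _ => 0) t x k ρ) : ∃ m, t m = t k ∧ SyncSet (x m) := by
  obtain ⟨m, hm, hm'⟩ := h.exists_last_le hc hk.le
  have hlt_of {s : ℕ} {i : Fin N} (hs : t s = t k)
      (hi : JumpStepAt E (fun _ => 0) t x s i) : s < m := by
    by_contra! hle
    rcases hle.eq_or_lt with rfl | hlt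
    · linarith [hi.1]
    · linarith [h.monotone (Nat.succ_le_of_lt hlt)]
  have htm : t m = t k := le_antisymm hm (h.monotone (hlt_of rfl hfire).le)
  have hflow := h.flowStep_of_lt (htm.trans_lt hm')
  have hzero {s : ℕ} {j : Fin N} (hs : t s = t k) (hsm : s ≤ m)
      (hj : x s j = 0 ∨ x s j = 1) : x m j = 0 :=
    (h.zero_or_one_of_le hsm (htm.trans hs.symm) hj).resolve_right
      (h.lt_one_of_flowStep hT hflow j).ne
  have hall : ∀ j, ∃ s, t s = t k ∧ JumpStepAt E (fun _ => 0) t x s j := by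
    intro j
    induction hρ j with
    | refl => exact ⟨k, rfl, hfire⟩
    | tail _ hE ih =>
      obtain ⟨s, hs, hi⟩ := ih
      have h0 := hzero (hi.1.trans hs) (hlt_of hs hi) (hi.zero_or_one_of_edge hE)
      obtain ⟨s', -, hs', hj⟩ := h.exists_fired_of_eq_zero hT (htm ▸ hk) h0
      exact ⟨s', hs'.trans htm, hj⟩
  refine ⟨m, htm, Or.inr fun j => Or.inl ?_⟩
  obtain ⟨s, hs, hj⟩ := hall j
  exact hzero (hj.1.trans hs) (hlt_of hs hj) (Or.inl hj.2.2.1)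

end Execution

theorem Acyclic.wellFounded_transGen {V : Type*} [Finite V] {E : V → V → Prop}
    (h : Acyclic E) : WellFounded (Relation.TransGen E) := by
  have : Std.Irrefl (Relation.TransGen E) := ⟨fun i hi => by
    obtain ⟨j, hij, hji⟩ := Relation.TransGen.head'_iff.1 hi
    exact h i j hij hji⟩
  exact Finite.wellFounded_of_trans_of_irrefl _

open Filter in
/-- Over an acyclic digraph, every agent fires only finitely often in a sequence of jumps. -/
theorem Acyclic.eventually_not_jumpStepAt {N : ℕ} {E : Fin N → Fin N → Prop} (h : Acyclic E)
    {r : Fin N → ℝ} {t : ℕ → ℝ} {x : ℕ → Fin N → ℝ} (hjump : ∀ k, JumpStep E r t x k)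
    (j : Fin N) : ∀ᶠ k in atTop, ¬ JumpStepAt E r t x k j := by
  induction j using h.wellFounded_transGen.induction with
  | _ j ih =>
    have hpred : ∀ᶠ k in atTop, ∀ i, E i j → ¬ JumpStepAt E r t x k i :=
      eventually_all.2 fun i => by
        by_cases hE : E i j
        · filter_upwards [ih i (.single hE)] with k hk _ using hk
        · exact .of_forall fun k hk => absurd hk hE
    obtain ⟨n, hn⟩ := eventually_atTop.1 hpred
    by_cases hfire : ∃ s ≥ n, JumpStepAt E r t x s j
    · obtain ⟨s, hs, hsj⟩ := hfire
      have hzero : ∀ k ≥ s + 1, x k j = 0 := by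
        intro k hk
        induction k, hk using Nat.le_induction with
        | base => exact hsj.2.2.1
        | succ k hk ihk =>
          obtain ⟨i, hi⟩ := hjump k
          by_cases hji : j = i
          · subst hji; exact hi.2.2.1
          · rw [(hi.2.2.2 j hji).2 fun hE => hn k (by omega) i hE hi, ihk]
      refine eventually_atTop.2 ⟨s + 1, fun k hk hkj => ?_⟩
      linarith [hzero k hk, hkj.2.1]
    · push Not at hfire
      exact eventually_atTop.2 ⟨n, hfire⟩


/-- over a rooted acyclic digraph with the zero partition vector,
(i) no execution consists exclusively of jump steps, and (ii) every complete
execution synchronizes within time `T`. -/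
theorem pco_rooted_acyclic_zero_partition_sync
    {N : ℕ} (E : Fin N → Fin N → Prop)
    (hsimple : ∀ i, ¬ E i i)
    (hrooted : ∃ i, IsRoot E i)
    (hacyclic : Acyclic E)
    (T : ℝ) (hT : 0 < T) :
    (∀ (t : ℕ → ℝ) (x : ℕ → Fin N → ℝ),
      IsExecution E T (fun _ => 0) t x →
        ¬ (∀ k, JumpStep E (fun _ => 0) t x k)) ∧
    (∀ (t : ℕ → ℝ) (x : ℕ → Fin N → ℝ),
      IsExecution E T (fun _ => 0) t x → Complete t →
        ∃ K : ℕ, t K ≤ T ∧ ∀ k ≥ K, SyncSet (x k)) := by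
  obtain ⟨ρ, hρ⟩ := hrooted
  refine ⟨fun t x _ hjump => ?_, fun t x h hc => ?_⟩
  · obtain ⟨k, hk⟩ := (Filter.eventually_all.2 (hacyclic.eventually_not_jumpStepAt hjump)).exists
    obtain ⟨i, hi⟩ := hjump k
    exact hk i hi
  · obtain ⟨k, hk, hkT, hfire⟩ :=
      h.exists_source_fires hT hc fun i hE => hacyclic i ρ hE (hρ i)
    obtain ⟨m, hm, hsync⟩ := h.exists_syncSet_of_root_fires hT hc hρ hk hfire
    exact ⟨m, hm.trans_le hkT, fun n hn => h.syncSet_of_le hT hn hsync⟩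
end

section
/- Let G be a digraph on N vertices that contains a directed cycle, let T > 0, and let r = (0,…,0). Then there exist an initial state x_0 ∈ [0,1]^N and an infinite execution of the PCO network over (G, T, r) starting from x_0 in which every step is a jump step (hence t_k = 0 for all k: a purely discrete, Zeno solution). -/
/-- A digraph with a directed cycle has an infinite directed walk. -/
theorem exists_infinite_walk_of_cycle {V : Type*} (E : V → V → Prop)
    (hcycle : ∃ i j, E i j ∧ Relation.ReflTransGen E j i) :
    ∃ f : ℕ → V, ∀ k, E (f k) (f (k + 1)) := by
  obtain ⟨c, d, hcd, hdc⟩ := hcycle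
  have step : ∀ v : {v // Relation.ReflTransGen E v c},
      ∃ w : {w // Relation.ReflTransGen E w c}, E v w := by
    rintro ⟨v, hv⟩
    rcases hv.cases_head with rfl | ⟨w, hvw, hwc⟩
    · exact ⟨⟨d, hdc⟩, hcd⟩
    · exact ⟨⟨w, hwc⟩, hvw⟩
  choose next hnext using step
  refine ⟨fun k => (next^[k] ⟨c, .refl⟩ : {v // Relation.ReflTransGen E v c}), fun k => ?_⟩
  simp only [Function.iterate_succ_apply']
  exact hnext _

open Classical in
/-- The phases obtained from the all-ones state when the agents `f 0, f 1, …` fire in turn and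
every firing agent sets all its out-neighbours to `1`. -/
noncomputable def firingPhase {V : Type*} (E : V → V → Prop) (f : ℕ → V) : ℕ → V → ℝ
  | 0, _ => 1
  | k + 1, v => if v = f k then 0 else if E (f k) v then 1 else firingPhase E f k v

theorem firingPhase_mem_Icc {V : Type*} (E : V → V → Prop) (f : ℕ → V) (k : ℕ) (v : V) :
    firingPhase E f k v ∈ Set.Icc (0 : ℝ) 1 := by
  induction k with
  | zero => simp [firingPhase]
  | succ k ih =>
    rw [firingPhase]
    split_ifs
    · simp
    · simp
    · exact ih

/-- Along a walk of a digraph without self-loops, the next agent to fire has phase `1`. -/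
theorem firingPhase_walk {V : Type*} {E : V → V → Prop} (hsimple : ∀ i, ¬ E i i)
    {f : ℕ → V} (hf : ∀ k, E (f k) (f (k + 1))) (k : ℕ) : firingPhase E f k (f k) = 1 := by
  cases k with
  | zero => rfl
  | succ k =>
    have hne : f (k + 1) ≠ f k := fun h => hsimple (f k) (h ▸ hf k)
    simp [firingPhase, hne, hf k]

/-- if the digraph contains a directed cycle and the partition
vector is zero, then there is an execution consisting exclusively of jump
steps (a purely discrete, Zeno solution, with `t_k = 0` for all `k`). -/
theorem pco_cycle_zero_partition_zeno
    {N : ℕ} (E : Fin N → Fin N → Prop)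
    (hsimple : ∀ i, ¬ E i i)
    (hcycle : ∃ i j, E i j ∧ Relation.ReflTransGen E j i)
    (T : ℝ) (hT : 0 < T) :
    ∃ (t : ℕ → ℝ) (x : ℕ → Fin N → ℝ),
      IsExecution E T (fun _ => 0) t x ∧
      (∀ k, JumpStep E (fun _ => 0) t x k) ∧
      (∀ k, t k = 0) := by
  obtain ⟨f, hf⟩ := exists_infinite_walk_of_cycle E hcycle
  have jump : ∀ k, JumpStep E (fun _ => 0) (fun _ => 0) (firingPhase E f) k := fun k => by
    refine ⟨f k, rfl, firingPhase_walk hsimple hf k, by simp [firingPhase], fun j hj =>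
      ⟨fun hE => ?_, fun hE => by simp [firingPhase, hj, hE]⟩⟩
    have hone : firingPhase E f (k + 1) j = 1 := by simp [firingPhase, hj, hE]
    exact ⟨fun h => absurd h (firingPhase_mem_Icc E f k j).1.not_gt, fun _ => hone,
      fun _ => Or.inr hone⟩
  exact ⟨fun _ => 0, firingPhase E f, ⟨rfl, firingPhase_mem_Icc E f, fun k => Or.inr (jump k)⟩,
    jump, fun _ => rfl⟩
end

section
/- Let G be a strongly connected digraph on N ≥ 2 vertices (every vertex is reachable from every other vertex), let T > 0, and let r ∈ (0, 1/(N−1))^N. Then every complete execution of the PCO network over (G, T, r) synchronizes within time 2T: there exists an index K with t_K ≤ 2T such that x_k ∈ A_s for all k ≥ K. -/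
section Network

variable {N : ℕ} {E : Fin N → Fin N → Prop} {T : ℝ} {r : Fin N → ℝ}
  {t : ℕ → ℝ} {x : ℕ → Fin N → ℝ}

theorem JumpStep.time_eq {k : ℕ} (h : JumpStep E r t x k) : t (k + 1) = t k :=
  let ⟨_, hi⟩ := h
  hi.1

theorem JumpStep.phase_eq {k : ℕ} (h : JumpStep E r t x k) (j : Fin N) :
    x (k + 1) j = x k j ∨ x (k + 1) j = 0 ∨ x (k + 1) j = 1 := by
  obtain ⟨i, -, -, hi, h⟩ := h
  by_cases hj : j = i
  · subst hj; exact Or.inr (Or.inl hi)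
  by_cases hE : E i j
  · obtain ⟨h1, h2, h3⟩ := (h j hj).1 hE
    rcases lt_trichotomy (x k j) (r j) with hl | hl | hl
    · exact Or.inr (Or.inl (h1 hl))
    · exact Or.inr (h3 hl)
    · exact Or.inr (Or.inr (h2 hl))
  · exact Or.inl ((h j hj).2 hE)

/-- A firing agent sends each of its out-neighbours to phase `0` or `1`. -/
theorem JumpStepAt.outNeighbor {k : ℕ} {i j : Fin N} (h : JumpStepAt E r t x k i) (hE : E i j) :
    x (k + 1) j = 0 ∨ x (k + 1) j = 1 := by
  obtain ⟨-, -, hi, h⟩ := h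
  by_cases hj : j = i
  · subst hj; exact Or.inl hi
  obtain ⟨h1, h2, h3⟩ := (h j hj).1 hE
  rcases lt_trichotomy (x k j) (r j) with hl | hl | hl
  · exact Or.inl (h1 hl)
  · exact h3 hl
  · exact Or.inr (h2 hl)

theorem FlowStep.phase_lt_one (hT : 0 < T) (hx : ∀ k i, x k i ∈ Set.Icc (0 : ℝ) 1) {k : ℕ}
    (h : FlowStep T t x k) (i : Fin N) : x k i < 1 := by
  have h1 := h.2 i
  have h2 := (hx (k + 1) i).2
  have h3 : 0 < (t (k + 1) - t k) / T := div_pos (sub_pos.2 h.1) hT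
  linarith

/-- From every step on, an execution flows until some agent fires. -/
theorem exists_next_jump (hN : 0 < N) (hT : 0 < T) (hexec : IsExecution E T r t x)
    (hcomp : Complete t) (a : ℕ) :
    ∃ b, a ≤ b ∧ JumpStep E r t x b ∧ t a ≤ t b ∧ (FlowStep T t x a → t a < t b) ∧
      ∀ i, x b i = x a i + (t b - t a) / T := by
  classical
  have flow : ∀ b, a ≤ b → (∀ k, a ≤ k → k < b → FlowStep T t x k) →
      t a ≤ t b ∧ (a < b → t a < t b) ∧ ∀ i, x b i = x a i + (t b - t a) / T := by
    intro b hab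
    induction b, hab using Nat.le_induction with
    | base => intro _; simp
    | succ b hab ih =>
      intro h
      obtain ⟨h1, -, h3⟩ := ih fun k hk hkb => h k hk (by omega)
      obtain ⟨h4, h5⟩ := h b hab (by omega)
      refine ⟨by linarith, fun _ => by linarith, fun i => ?_⟩
      rw [h5, h3]
      ring
  by_cases hex : ∃ b, a ≤ b ∧ JumpStep E r t x b
  · obtain ⟨hab, hb⟩ := Nat.find_spec hex
    obtain ⟨h1, h2, h3⟩ := flow _ hab fun k hk hkb =>
      (hexec.2.2 k).resolve_right fun hj => Nat.find_min hex hkb ⟨hk, hj⟩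
    refine ⟨_, hab, hb, h1, fun hf => h2 (lt_of_le_of_ne hab fun he => ?_), h3⟩
    rw [← he] at hb
    exact hf.1.ne' hb.time_eq
  · push Not at hex
    have hflow : ∀ k, a ≤ k → FlowStep T t x k := fun k hk =>
      (hexec.2.2 k).resolve_right (hex k hk)
    have hmono : Monotone t := monotone_nat_of_le_succ fun k => by
      rcases hexec.2.2 k with h | h
      · exact h.1.le
      · exact h.time_eq.ge
    obtain ⟨k, hk⟩ := hcomp (t a + T)
    have hak : a ≤ k := by
      by_contra hlt
      have := hmono (not_le.1 hlt).le
      linarith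
    have h3 := (flow k hak fun l hl _ => hflow l hl).2.2 ⟨0, hN⟩
    have h4 := (hexec.2.1 k ⟨0, hN⟩).2
    have h5 := (hexec.2.1 a ⟨0, hN⟩).1
    have h6 : 1 < (t k - t a) / T := by rw [lt_div_iff₀ hT]; linarith
    linarith

/-- From every step on, a complete execution makes finitely many jumps before it flows. -/
theorem exists_next_flow (hexec : IsExecution E T r t x) (hcomp : Complete t) (a : ℕ) :
    ∃ c, a ≤ c ∧ FlowStep T t x c ∧ t c = t a ∧ ∀ k, a ≤ k → k < c → JumpStep E r t x k := by
  classical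
  have jump : ∀ c, a ≤ c → (∀ k, a ≤ k → k < c → JumpStep E r t x k) → t c = t a := by
    intro c hac
    induction c, hac using Nat.le_induction with
    | base => intro _; rfl
    | succ c hac ih =>
      intro h
      rw [(h c hac (by omega)).time_eq, ih fun k hk hkc => h k hk (by omega)]
  by_cases hex : ∃ c, a ≤ c ∧ FlowStep T t x c
  · obtain ⟨hac, hc⟩ := Nat.find_spec hex
    have hj : ∀ k, a ≤ k → k < Nat.find hex → JumpStep E r t x k := fun k hk hkc =>
      (hexec.2.2 k).resolve_left fun hf => Nat.find_min hex hkc ⟨hk, hf⟩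
    exact ⟨_, hac, hc, jump _ hac hj, hj⟩
  · push Not at hex
    have hmono : Monotone t := monotone_nat_of_le_succ fun k => by
      rcases hexec.2.2 k with h | h
      · exact h.1.le
      · exact h.time_eq.ge
    obtain ⟨k, hk⟩ := hcomp (t a)
    rcases le_total a k with hak | hka
    · exact absurd (jump k hak fun l hl _ => (hexec.2.2 l).resolve_left (hex l hl)) hk.ne'
    · exact absurd (hmono hka) (not_le.2 hk)

/-- A bound on the phase of an agent survives a run of jumps, since an agent sent to phase `1`
has to fire before the network flows. -/
theorem phase_le_of_jumps (hT : 0 < T) (hx : ∀ k i, x k i ∈ Set.Icc (0 : ℝ) 1) {b c : ℕ}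
    (hbc : b ≤ c) (hj : ∀ k, b ≤ k → k < c → JumpStep E r t x k) (hc : FlowStep T t x c)
    {B : ℝ} (hB : 0 ≤ B) {i : Fin N} (hi : x b i ≤ B ∨ x b i = 1) : x c i ≤ B := by
  have key : ∀ c, b ≤ c → (∀ k, b ≤ k → k < c → JumpStep E r t x k) →
      x c i ≤ B ∨ x c i = 1 := by
    intro c hbc
    induction c, hbc using Nat.le_induction with
    | base => exact fun _ => hi
    | succ c hbc ih =>
      intro h
      rcases (h c hbc (by omega)).phase_eq i with h1 | h1 | h1
      · rw [h1]; exact ih fun k hk hkc => h k hk (by omega)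
      · exact Or.inl (h1.le.trans hB)
      · exact Or.inr h1
  exact (key c hbc hj).resolve_right (hc.phase_lt_one hT hx i).ne

/-- If all phases exceed the partition values when an agent fires, then the firing cascades
through the whole network. -/
theorem phase_eq_zero_of_cascade (hT : 0 < T) (hx : ∀ k i, x k i ∈ Set.Icc (0 : ℝ) 1)
    (hsc : ∀ i j : Fin N, Relation.ReflTransGen E i j) (hr : ∀ i, 0 < r i) {b c : ℕ}
    (hbc : b < c) (hj : ∀ k, b ≤ k → k < c → JumpStep E r t x k) (hc : FlowStep T t x c)
    (hb : ∀ i, r i < x b i) (i : Fin N) : x c i = 0 := by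
  have key : ∀ c, b ≤ c → (∀ k, b ≤ k → k < c → JumpStep E r t x k) →
      (∀ i, x c i = 0 ∨ r i < x c i) ∧
      ∀ i j, x c i = 0 → E i j → x c j = 0 ∨ x c j = 1 := by
    intro c hbc
    induction c, hbc using Nat.le_induction with
    | base =>
      refine fun _ => ⟨fun i => Or.inr (hb i), fun i j hi => ?_⟩
      have := hb i
      have := hr i
      linarith
    | succ c hbc ih =>
      intro h
      obtain ⟨h1, h2⟩ := ih fun k hk hkc => h k hk (by omega)
      have hjc := h c hbc (by omega)
      have ⟨f, hf⟩ := hjc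
      have step : ∀ i, i ≠ f → x (c + 1) i = x c i ∨ (x (c + 1) i = 1 ∧ r i < x c i) := by
        intro i hif
        by_cases hE : E f i
        · obtain ⟨g1, g2, -⟩ := (hf.2.2.2 i hif).1 hE
          rcases h1 i with h0 | h0
          · exact Or.inl ((g1 (h0 ▸ hr i)).trans h0.symm)
          · exact Or.inr ⟨g2 h0, h0⟩
        · exact Or.inl ((hf.2.2.2 i hif).2 hE)
      refine ⟨fun i => ?_, fun i j hi hE => ?_⟩
      · by_cases hif : i = f
        · subst hif; exact Or.inl hf.2.2.1
        rcases step i hif with h3 | ⟨h3, h4⟩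
        · rw [h3]; exact h1 i
        · exact Or.inr (h3 ▸ h4.trans_le (hx c i).2)
      · by_cases hif : i = f
        · subst hif; exact hf.outNeighbor hE
        have hi0 : x c i = 0 := by
          rcases step i hif with h3 | ⟨h3, -⟩
          · rw [← h3, hi]
          · exact absurd (h3.symm.trans hi) one_ne_zero
        rcases hjc.phase_eq j with h3 | h3
        · rw [h3]; exact h2 i j hi0 hE
        · exact h3
  have hclosed := (key c hbc.le hj).2
  obtain ⟨c, rfl⟩ : ∃ d, c = d + 1 := ⟨c - 1, by omega⟩
  obtain ⟨f, hf⟩ := hj c (by omega) (by omega)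
  induction hsc f i with
  | refl => exact hf.2.2.1
  | tail _ hE ih => exact (hclosed _ _ ih hE).resolve_right (hc.phase_lt_one hT hx _).ne

theorem SyncSet.succ (hT : 0 < T) (hexec : IsExecution E T r t x) {k : ℕ}
    (h : SyncSet (x k)) : SyncSet (x (k + 1)) := by
  rcases hexec.2.2 k with hf | ⟨f, hf⟩
  · refine Or.inl fun i j => ?_
    have heq : x k i = x k j := by
      rcases h with h | h
      · exact h i j
      · rw [(h i).resolve_right (hf.phase_lt_one hT hexec.2.1 i).ne,
          (h j).resolve_right (hf.phase_lt_one hT hexec.2.1 j).ne]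
    rw [hf.2, hf.2, heq]
  · refine Or.inr fun j => ?_
    have hj : x k j = 0 ∨ x k j = 1 := by
      rcases h with h | h
      · exact Or.inr ((h j f).trans hf.2.1)
      · exact h j
    rcases JumpStep.phase_eq ⟨f, hf⟩ j with h1 | h1
    · rw [h1]; exact hj
    · exact h1

/-- If the network flows for at least `T / (N - 1)` before an agent fires, then it is
synchronized by the end of that firing. -/
theorem sync_of_long_flow (hT : 0 < T) (hN : 2 ≤ N) (hexec : IsExecution E T r t x)
    (hcomp : Complete t) (hsc : ∀ i j : Fin N, Relation.ReflTransGen E i j)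
    (hr : ∀ i, r i ∈ Set.Ioo (0 : ℝ) (1 / (N - 1 : ℝ))) {a b : ℕ}
    (hb : JumpStep E r t x b) (hab : ∀ i, x b i = x a i + (t b - t a) / T)
    (hlong : T ≤ (t b - t a) * (N - 1 : ℝ)) :
    ∃ K : ℕ, t K = t b ∧ ∀ k ≥ K, SyncSet (x k) := by
  have hN' : (2 : ℝ) ≤ N := by exact_mod_cast hN
  obtain ⟨c, hbc, hc, htc, hj⟩ := exists_next_flow hexec hcomp b
  have hlt : b < c := lt_of_le_of_ne hbc fun he => by
    subst he; exact hc.1.ne' hb.time_eq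
  have hbig : ∀ i, r i < x b i := fun i => by
    have h1 := (hr i).2
    have h2 : 1 / (N - 1 : ℝ) ≤ (t b - t a) / T := by
      rw [div_le_div_iff₀ (by linarith) hT]; linarith
    have h3 := (hexec.2.1 a i).1
    rw [hab]; linarith
  have hzero := phase_eq_zero_of_cascade hT hexec.2.1 hsc (fun i => (hr i).1) hlt hj hc hbig
  refine ⟨c, htc, fun k hk => ?_⟩
  induction k, hk using Nat.le_induction with
  | base => exact Or.inr fun i => Or.inl (hzero i)
  | succ k _ ih => exact ih.succ hT hexec

end Network

/-- over a strongly connected digraph on `N ≥ 2` vertices and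
`r ∈ (0, 1/(N-1))^N`, every complete execution synchronizes within time `2T`. -/
theorem pco_strongly_connected_sync_two_periods
    {N : ℕ} (hN : 2 ≤ N) (E : Fin N → Fin N → Prop)
    (hsimple : ∀ i, ¬ E i i)
    (hsc : ∀ i j : Fin N, Relation.ReflTransGen E i j)
    (T : ℝ) (hT : 0 < T)
    (r : Fin N → ℝ) (hr : ∀ i, r i ∈ Set.Ioo (0 : ℝ) (1 / (N - 1 : ℝ)))
    (t : ℕ → ℝ) (x : ℕ → Fin N → ℝ)
    (hexec : IsExecution E T r t x) (hcomp : Complete t) :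
    ∃ K : ℕ, t K ≤ 2 * T ∧ ∀ k ≥ K, SyncSet (x k) := by
  have hN' : (2 : ℝ) ≤ N := by exact_mod_cast hN
  have hx := hexec.2.1
  by_contra hns
  have short : ∀ a b, JumpStep E r t x b → (∀ i, x b i = x a i + (t b - t a) / T) →
      t a ≤ T → (t b - t a) * (N - 1 : ℝ) < T := by
    intro a b hb hab ha
    by_contra hlong
    obtain ⟨K, hK, hs⟩ := sync_of_long_flow hT hN hexec hcomp hsc hr hb hab (not_lt.1 hlong)
    refine hns ⟨K, ?_, hs⟩
    have h1 := hab ⟨0, by omega⟩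
    have h2 := (hx b ⟨0, by omega⟩).2
    have h3 := (hx a ⟨0, by omega⟩).1
    have h4 : (t b - t a) / T ≤ 1 := by linarith
    rw [div_le_one hT] at h4
    linarith
  obtain ⟨s, -, hs, -, -, hs0⟩ := exists_next_jump (by omega) hT hexec hcomp 0
  have hs1 := short 0 s hs hs0 (by rw [hexec.1]; exact hT.le)
  rw [hexec.1, sub_zero] at hs1
  -- The agents of `S` cannot flow to phase `1` before time `t s + T`.
  have key : ∀ n : ℕ, ∃ a, ∃ S : Finset (Fin N), FlowStep T t x a ∧ n + 2 ≤ S.card ∧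
      t s ≤ t a ∧ (t a - t s) * (N - 1 : ℝ) ≤ n * T ∧ ∀ i ∈ S, x a i ≤ (t a - t s) / T := by
    intro n
    induction n with
    | zero =>
      obtain ⟨i, hi⟩ := hs
      obtain ⟨c, hsc', hc, htc, hj⟩ := exists_next_flow hexec hcomp (s + 1)
      rw [hi.1] at htc
      obtain ⟨j, hE⟩ : ∃ j, E i j := by
        have : Nontrivial (Fin N) := Fin.nontrivial_iff_two_le.2 hN
        obtain ⟨l, hl⟩ := exists_ne i
        rcases (hsc i l).cases_head with h | ⟨j, hE, -⟩
        · exact absurd h.symm hl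
        · exact ⟨j, hE⟩
      have hij : i ≠ j := fun h => hsimple i (h ▸ hE)
      refine ⟨c, {i, j}, hc, by rw [Finset.card_pair hij], htc.ge, by simp [htc], fun l hl => ?_⟩
      rw [htc, sub_self, zero_div]
      refine phase_le_of_jumps hT hx hsc' hj hc le_rfl ?_
      rcases Finset.mem_insert.1 hl with rfl | hl
      · exact Or.inl hi.2.2.1.le
      · rw [Finset.mem_singleton.1 hl]
        exact (hi.outNeighbor hE).imp le_of_eq id
    | succ n ih =>
      obtain ⟨a, S, ha, hS, hsa, hta, hle⟩ := ih
      have hn : (n : ℝ) + 2 ≤ N := by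
        have := hS.trans (S.card_le_univ.trans_eq (Fintype.card_fin N))
        exact_mod_cast this
      have hnT : ((n : ℝ) + 2) * T ≤ N * T := mul_le_mul_of_nonneg_right hn hT.le
      obtain ⟨b, -, hb, -, hlt, hab⟩ := exists_next_jump (by omega) hT hexec hcomp a
      have hgap := short a b hb hab (by
        refine le_of_mul_le_mul_right ?_ (by linarith : (0 : ℝ) < N - 1)
        linarith)
      have hlt := hlt ha
      have hbT : (t b - t s) / T < 1 := by
        rw [div_lt_one hT]
        refine lt_of_mul_lt_mul_right ?_ (by linarith : (0 : ℝ) ≤ N - 1)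
        linarith
      have hbS : ∀ i ∈ S, x b i ≤ (t b - t s) / T := fun i hi => by
        have h1 := hle i hi
        have h2 : (t b - t s) / T = (t a - t s) / T + (t b - t a) / T := by ring
        rw [hab, h2]; linarith
      obtain ⟨c, hbc, hc, htc, hj⟩ := exists_next_flow hexec hcomp b
      obtain ⟨f, hf⟩ := hb
      have hfS : f ∉ S := fun h => by
        have h1 := hbS f h
        have h2 := hf.2.1
        linarith
      refine ⟨c, insert f S, hc, by rw [Finset.card_insert_of_notMem hfS]; omega,
        by linarith, by rw [htc]; push_cast; linarith, fun i hi => ?_⟩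
      rw [htc]
      refine phase_le_of_jumps hT hx hbc hj hc (div_nonneg (by linarith) hT.le) ?_
      rcases Finset.mem_insert.1 hi with rfl | hi
      · exact Or.inr hf.2.1
      · exact Or.inl (hbS i hi)
  obtain ⟨-, S, -, hS, -⟩ := key N
  have := hS.trans (S.card_le_univ.trans_eq (Fintype.card_fin N))
  omega
end

section
/- Let G be the directed 3-cycle on vertices {1,2,3} with edge set {(1,2),(2,3),(3,1)} (a strongly connected digraph), and let T > 0. Then for every partition vector r ∈ (1/2, 1]^3 there exist an initial state x_0 ∈ [0,1]^3 and a complete execution of the PCO network over (G, T, r) starting from x_0 such that x_k ∉ A_s for every k; in particular global synchronization fails and (r, G) is not a sync-pair. -/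
/-- The phases along a periodic orbit of the directed 3-cycle: the states at even steps flow for
half a period, those at odd steps jump. -/
noncomputable def cyclePhase (k : ℕ) : Fin 3 → ℝ :=
  match k % 6 with
  | 0 => ![0, 0, 1 / 2]
  | 1 => ![1 / 2, 1 / 2, 1]
  | 2 => ![0, 1 / 2, 0]
  | 3 => ![1 / 2, 1, 1 / 2]
  | 4 => ![1 / 2, 0, 0]
  | _ => ![1, 1 / 2, 1 / 2]

/-- The times along the periodic orbit `cyclePhase`. -/
noncomputable def cycleTime (T : ℝ) (k : ℕ) : ℝ := ((k + 1) / 2 : ℕ) * (T / 2)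

theorem cycleTime_succ_of_even (T : ℝ) {k : ℕ} (hk : k % 2 = 0) :
    cycleTime T (k + 1) = cycleTime T k + T / 2 := by
  have h : (k + 1 + 1) / 2 = (k + 1) / 2 + 1 := by omega
  simp only [cycleTime, h]
  push_cast
  ring

theorem cycleTime_succ_of_odd (T : ℝ) {k : ℕ} (hk : k % 2 = 1) :
    cycleTime T (k + 1) = cycleTime T k := by
  have h : (k + 1 + 1) / 2 = (k + 1) / 2 := by omega
  simp only [cycleTime, h]

theorem complete_cycleTime {T : ℝ} (hT : 0 < T) : Complete (cycleTime T) := by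
  intro M
  obtain ⟨n, hn⟩ := exists_nat_gt (M / (T / 2))
  refine ⟨2 * n, ?_⟩
  have h : (2 * n + 1) / 2 = n := by omega
  rw [cycleTime, h]
  exact (div_lt_iff₀ (half_pos hT)).mp hn

theorem cyclePhase_mem_Icc (k : ℕ) (i : Fin 3) : cyclePhase k i ∈ Set.Icc (0 : ℝ) 1 := by
  have h : k % 6 < 6 := Nat.mod_lt _ (by norm_num)
  unfold cyclePhase
  interval_cases k % 6 <;> fin_cases i <;> norm_num

theorem not_syncSet_cyclePhase (k : ℕ) : ¬ SyncSet (cyclePhase k) := by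
  have h : k % 6 < 6 := Nat.mod_lt _ (by norm_num)
  unfold cyclePhase SyncSet
  interval_cases k % 6 <;> norm_num [Fin.forall_fin_succ]

theorem cyclePhase_succ_of_even {k : ℕ} (hk : k % 2 = 0) (i : Fin 3) :
    cyclePhase (k + 1) i = cyclePhase k i + 1 / 2 := by
  obtain ⟨h, h'⟩ | ⟨h, h'⟩ | ⟨h, h'⟩ : (k % 6 = 0 ∧ (k + 1) % 6 = 1) ∨
      (k % 6 = 2 ∧ (k + 1) % 6 = 3) ∨ (k % 6 = 4 ∧ (k + 1) % 6 = 5) := by omega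
  all_goals
    simp only [cyclePhase, h, h']
    fin_cases i <;> norm_num

theorem flowStep_cyclePhase {T : ℝ} (hT : 0 < T) {k : ℕ} (hk : k % 2 = 0) :
    FlowStep T (cycleTime T) cyclePhase k := by
  simp only [FlowStep, cycleTime_succ_of_even T hk, cyclePhase_succ_of_even hk]
  refine ⟨by linarith, fun i => ?_⟩
  field_simp
  ring

theorem jumpStep_cyclePhase (T : ℝ) {E : Fin 3 → Fin 3 → Prop}
    (hE : ∀ i j, E i j ↔ ((i, j) = ((0 : Fin 3), (1 : Fin 3)) ∨
      (i, j) = ((1 : Fin 3), (2 : Fin 3)) ∨ (i, j) = ((2 : Fin 3), (0 : Fin 3))))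
    {r : Fin 3 → ℝ} (hr : ∀ i, 1 / 2 < r i) {k : ℕ} (hk : k % 2 = 1) :
    JumpStep E r (cycleTime T) cyclePhase k := by
  have h0 := hr 0
  have h1 := hr 1
  have h2 := hr 2
  obtain ⟨h, h'⟩ | ⟨h, h'⟩ | ⟨h, h'⟩ : (k % 6 = 1 ∧ (k + 1) % 6 = 2) ∨
      (k % 6 = 3 ∧ (k + 1) % 6 = 4) ∨ (k % 6 = 5 ∧ (k + 1) % 6 = 0) := by omega
  · refine ⟨2, cycleTime_succ_of_odd T hk, ?_⟩
    simp [cyclePhase, h, h', hE, Fin.forall_fin_succ]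
    grind
  · refine ⟨1, cycleTime_succ_of_odd T hk, ?_⟩
    simp [cyclePhase, h, h', hE, Fin.forall_fin_succ]
    grind
  · refine ⟨0, cycleTime_succ_of_odd T hk, ?_⟩
    simp [cyclePhase, h, h', hE, Fin.forall_fin_succ]
    grind

/-- on the directed 3-cycle, for every partition vector
`r ∈ (1/2, 1]^3` there is a complete execution that never synchronizes. -/
theorem pco_three_cycle_large_r_no_sync
    (T : ℝ) (hT : 0 < T)
    (E : Fin 3 → Fin 3 → Prop)
    (hE : ∀ i j, E i j ↔ ((i, j) = ((0 : Fin 3), (1 : Fin 3)) ∨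
      (i, j) = ((1 : Fin 3), (2 : Fin 3)) ∨ (i, j) = ((2 : Fin 3), (0 : Fin 3))))
    (r : Fin 3 → ℝ) (hr : ∀ i, r i ∈ Set.Ioc (1 / 2 : ℝ) 1) :
    ∃ (t : ℕ → ℝ) (x : ℕ → Fin 3 → ℝ),
      IsExecution E T r t x ∧ Complete t ∧ ∀ k, ¬ SyncSet (x k) := by
  refine ⟨cycleTime T, cyclePhase, ⟨by simp [cycleTime], cyclePhase_mem_Icc, fun k => ?_⟩,
    complete_cycleTime hT, not_syncSet_cyclePhase⟩
  obtain hk | hk := Nat.mod_two_eq_zero_or_one k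
  · exact Or.inl (flowStep_cyclePhase hT hk)
  · exact Or.inr (jumpStep_cyclePhase T hE (fun i => (hr i).1) hk)
end

section
/- Let G be a digraph on N ≥ 2 vertices that has no root, let T > 0, and let r ∈ [0,1]^N be arbitrary. Then there exist an initial state x_0 ∈ [0,1]^N and a complete execution of the PCO network over (G, T, r) starting from x_0 such that x_k ∉ A_s for every k; in particular, being rooted is necessary for (r, G) to be a sync-pair. -/
/-- Phases lie on the half-integer grid, those in `A` are extremal and those in `B` equal `1/2`. -/
def Antiphase {N : ℕ} (A B : Set (Fin N)) (x : Fin N → ℝ) : Prop :=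
  (∀ i, x i = 0 ∨ x i = 1 / 2 ∨ x i = 1) ∧ (∀ i ∈ A, x i = 0 ∨ x i = 1) ∧ ∀ i ∈ B, x i = 1 / 2

open Classical in
/-- The number of agents with nonzero phase. -/
noncomputable def nonzeroCount {N : ℕ} (x : Fin N → ℝ) : ℕ :=
  (Finset.univ.filter fun i => x i ≠ 0).card

open Classical in
/-- The state after agent `i` fires, where agents sitting at their threshold are reset to `0`. -/
noncomputable def fire {N : ℕ} (E : Fin N → Fin N → Prop) (r x : Fin N → ℝ) (i j : Fin N) : ℝ :=
  if j = i then 0 else if E i j then (if r j < x j then 1 else 0) else x j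

lemma nonzeroCount_le {N : ℕ} (x : Fin N → ℝ) : nonzeroCount x ≤ N := by
  classical
  simpa [nonzeroCount] using Finset.card_le_univ (Finset.univ.filter fun i => x i ≠ 0)

lemma nonzeroCount_fire_lt {N : ℕ} (E : Fin N → Fin N → Prop) {r x : Fin N → ℝ}
    (hr : ∀ i, 0 ≤ r i) {i : Fin N} (hi : x i = 1) :
    nonzeroCount (fire E r x i) < nonzeroCount x := by
  classical
  refine Finset.card_lt_card (Finset.ssubset_iff_of_subset ?_ |>.mpr ⟨i, ?_, ?_⟩)
  · intro j
    simp only [Finset.mem_filter, Finset.mem_univ, true_and]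
    intro h h0
    simp [fire, h0, not_lt.mpr (hr j)] at h
  · simp [hi]
  · simp [fire]

lemma Antiphase.not_syncSet {N : ℕ} {A B : Set (Fin N)} {x : Fin N → ℝ}
    (hx : Antiphase A B x) (hA : A.Nonempty) (hB : B.Nonempty) : ¬ SyncSet x := by
  obtain ⟨a, ha⟩ := hA
  obtain ⟨b, hb⟩ := hB
  have hxb := hx.2.2 b hb
  rintro (h | h)
  · have := h a b
    rcases hx.2.1 a ha with h' | h' <;> norm_num [h', hxb] at this
  · have := h b
    norm_num [hxb] at this

lemma Antiphase.fire {N : ℕ} {A B : Set (Fin N)} {x : Fin N → ℝ} {E : Fin N → Fin N → Prop}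
    (hx : Antiphase A B x) (hB : ∀ i j, E i j → j ∈ B → i ∈ B) (r : Fin N → ℝ) {i : Fin N}
    (hi : x i = 1) : Antiphase A B (fire E r x i) := by
  have hiB : i ∉ B := fun h => by
    have := hx.2.2 i h
    norm_num [hi] at this
  refine ⟨fun j => ?_, fun j hj => ?_, fun j hj => ?_⟩
  · have := hx.1 j
    unfold _root_.fire
    split_ifs <;> simp_all
  · have := hx.2.1 j hj
    unfold _root_.fire
    split_ifs <;> simp_all
  · have hji : j ≠ i := fun h => hiB (h ▸ hj)
    have hE : ¬ E i j := fun h => hiB (hB i j h hj)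
    simp [_root_.fire, hji, hE, hx.2.2 j hj]

lemma Antiphase.flow {N : ℕ} {A B : Set (Fin N)} {x : Fin N → ℝ}
    (hx : Antiphase A B x) (h1 : ∀ i, x i ≠ 1) : Antiphase B A (fun i => x i + 1 / 2) := by
  refine ⟨fun j => ?_, fun j hj => ?_, fun j hj => ?_⟩
  · rcases hx.1 j with h | h | h
    · norm_num [h]
    · norm_num [h]
    · exact absurd h (h1 j)
  · norm_num [hx.2.2 j hj]
  · norm_num [(hx.2.1 j hj).resolve_right (h1 j)]

/-- A one-step transition of duration `d` from `x` to `y`. -/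
def Transition {N : ℕ} (E : Fin N → Fin N → Prop) (T : ℝ) (r : Fin N → ℝ) (x y : Fin N → ℝ)
    (d : ℝ) : Prop :=
  (d = T / 2 ∧ ∀ i, y i = x i + 1 / 2) ∨ (d = 0 ∧ ∃ i, x i = 1 ∧ y = fire E r x i)

lemma Antiphase.exists_transition {N : ℕ} {A B : Set (Fin N)} {x : Fin N → ℝ}
    {E : Fin N → Fin N → Prop} {T : ℝ} (hT : 0 < T) {r : Fin N → ℝ} (hr : ∀ i, 0 ≤ r i)
    (hB : ∀ i j, E i j → j ∈ B → i ∈ B) (hx : Antiphase A B x) :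
    ∃ y d, (Antiphase A B y ∨ Antiphase B A y) ∧ Transition E T r x y d ∧
      (nonzeroCount y : ℝ) + 1 ≤ nonzeroCount x + 2 * (N + 1) / T * d := by
  by_cases h1 : ∃ i, x i = 1
  · obtain ⟨i, hi⟩ := h1
    refine ⟨_root_.fire E r x i, 0, .inl (hx.fire hB r hi), .inr ⟨rfl, i, hi, rfl⟩, ?_⟩
    have := nonzeroCount_fire_lt E hr hi
    simp only [mul_zero, add_zero]
    exact_mod_cast this
  · push Not at h1
    refine ⟨fun i => x i + 1 / 2, T / 2, .inr (hx.flow h1), .inl ⟨rfl, fun _ => rfl⟩, ?_⟩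
    have h := nonzeroCount_le (fun i => x i + 1 / 2)
    have h' : (nonzeroCount (fun i => x i + 1 / 2) : ℝ) ≤ N := by exact_mod_cast h
    have e : 2 * ((N : ℝ) + 1) / T * (T / 2) = N + 1 := by field_simp
    rw [e]
    have : (0 : ℝ) ≤ nonzeroCount x := Nat.cast_nonneg _
    linarith

lemma Transition.flowStep_or_jumpStep {N : ℕ} {E : Fin N → Fin N → Prop} {T : ℝ} (hT : 0 < T)
    {r : Fin N → ℝ} {t : ℕ → ℝ} {x : ℕ → Fin N → ℝ} {k : ℕ}
    (h : Transition E T r (x k) (x (k + 1)) (t (k + 1) - t k)) :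
    FlowStep T t x k ∨ JumpStep E r t x k := by
  rcases h with ⟨hd, hy⟩ | ⟨hd, i, hi, hy⟩
  · refine .inl ⟨by linarith, fun i => ?_⟩
    rw [hy, hd]
    field_simp
  · refine .inr ⟨i, by linarith, hi, by simp [hy, fire], fun j hj => ⟨fun hE => ?_, fun hE => ?_⟩⟩
    · rw [hy]
      refine ⟨fun h => ?_, fun h => ?_, fun h => .inl ?_⟩
      · simp [fire, hj, hE, h.le]
      · simp [fire, hj, hE, h]
      · simp [fire, hj, hE, h]
    · simp [hy, fire, hj, hE]

/-- A finite nonempty digraph without a root has two disjoint nonempty sets of vertices, each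
closed under predecessors. -/
lemma exists_disjoint_predecessor_closed {V : Type*} [Finite V] [Nonempty V] {E : V → V → Prop}
    (h : ¬ ∃ i, IsRoot E i) : ∃ A B : Set V, A.Nonempty ∧ B.Nonempty ∧ Disjoint A B ∧
      (∀ i j, E i j → j ∈ A → i ∈ A) ∧ ∀ i j, E i j → j ∈ B → i ∈ B := by
  obtain ⟨a, b, hab⟩ : ∃ a b, ∀ c,
      Relation.ReflTransGen E c a → ¬ Relation.ReflTransGen E c b := by
    by_contra! hdir
    have D : Directed (Function.swap (Relation.ReflTransGen E)) (id : V → V) := hdir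
    obtain ⟨z, hz⟩ := D.finite_le (id : V → V)
    exact h ⟨z, hz⟩
  exact ⟨{c | Relation.ReflTransGen E c a}, {c | Relation.ReflTransGen E c b}, ⟨a, .refl⟩,
    ⟨b, .refl⟩, Set.disjoint_left.mpr hab, fun _ _ hij hj => .head hij hj, fun _ _ hij hj => .head hij hj⟩

/-- if the digraph has no root, then for any partition vector
there is a complete execution that never synchronizes; rootedness is
necessary for `(r, G)` to be a sync-pair. -/
theorem pco_no_root_no_sync
    {N : ℕ} (hN : 2 ≤ N) (E : Fin N → Fin N → Prop)
    (hsimple : ∀ i, ¬ E i i)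
    (hnoroot : ¬ ∃ i, IsRoot E i)
    (T : ℝ) (hT : 0 < T)
    (r : Fin N → ℝ) (hr : ∀ i, r i ∈ Set.Icc (0 : ℝ) 1) :
    ∃ (t : ℕ → ℝ) (x : ℕ → Fin N → ℝ),
      IsExecution E T r t x ∧ Complete t ∧ ∀ k, ¬ SyncSet (x k) := by
  have : Nonempty (Fin N) := ⟨⟨0, by omega⟩⟩
  obtain ⟨A, B, hA, hB, hAB, hAE, hBE⟩ := exists_disjoint_predecessor_closed hnoroot
  have hr0 : ∀ i, 0 ≤ r i := fun i => (hr i).1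
  classical
  let S := {x : Fin N → ℝ // Antiphase A B x ∨ Antiphase B A x}
  have step : ∀ x : S, ∃ (y : S) (d : ℝ), Transition E T r x.1 y.1 d ∧
      (nonzeroCount y.1 : ℝ) + 1 ≤ nonzeroCount x.1 + 2 * (N + 1) / T * d := by
    rintro ⟨x, hx | hx⟩
    · obtain ⟨y, d, hy, h⟩ := hx.exists_transition hT hr0 hBE
      exact ⟨⟨y, hy⟩, d, h⟩
    · obtain ⟨y, d, hy, h⟩ := hx.exists_transition hT hr0 hAE
      exact ⟨⟨y, hy.symm⟩, d, h⟩
  choose next dur htrans hcount using step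
  let x₀ : S := ⟨fun i => if i ∈ B then 1 / 2 else 0, .inl
    ⟨fun i => by by_cases h : i ∈ B <;> simp [h],
      fun i hi => by simp [Set.disjoint_left.mp hAB hi], fun i hi => by simp [hi]⟩⟩
  let s : ℕ → S := fun k => next^[k] x₀
  have hs : ∀ k, s (k + 1) = next (s k) := fun k => Function.iterate_succ_apply' next k x₀
  let t : ℕ → ℝ := fun k => ∑ i ∈ Finset.range k, dur (s i)
  have ht : ∀ k, t (k + 1) - t k = dur (s k) := fun k => by
    simp [t, Finset.sum_range_succ]
  have hgrow : ∀ k : ℕ, (k : ℝ) + nonzeroCount (s k).1 ≤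
      nonzeroCount (s 0).1 + 2 * (N + 1) / T * t k := by
    intro k
    induction k with
    | zero => simp [t]
    | succ k ih =>
      have h := hcount (s k)
      rw [← hs, ← ht, mul_sub] at h
      push_cast
      linarith
  refine ⟨t, fun k => (s k).1, ⟨by simp [t], fun k i => ?_, fun k => ?_⟩, fun M => ?_, fun k => ?_⟩
  · have hgrid : (s k).1 i = 0 ∨ (s k).1 i = 1 / 2 ∨ (s k).1 i = 1 :=
      (s k).2.elim (fun h => h.1 i) (fun h => h.1 i)
    rcases hgrid with h | h | h <;> norm_num [h]
  · refine Transition.flowStep_or_jumpStep hT ?_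
    rw [ht, hs]
    exact htrans (s k)
  · have hc : (0 : ℝ) < 2 * (N + 1) / T := by positivity
    obtain ⟨k, hk⟩ := exists_nat_gt (nonzeroCount (s 0).1 + 2 * (N + 1) / T * M)
    refine ⟨k, lt_of_mul_lt_mul_left ?_ hc.le⟩
    have : (0 : ℝ) ≤ nonzeroCount (s k).1 := Nat.cast_nonneg _
    linarith [hgrow k]
  · exact (s k).2.elim (fun h => h.not_syncSet hA hB) (fun h => h.not_syncSet hB hA)
end

section
/- Let G be the digraph on vertices {1,2,3} with edge set {(1,2),(2,3),(3,2)}, which is rooted with root 1, and let T > 0. Then for every partition vector r ∈ (0,1]^3 there exist an initial state x_0 ∈ [0,1]^3 and a complete execution of the PCO network over (G, T, r) starting from x_0 such that x_k ∉ A_s for every k; in particular, G being rooted is not sufficient for (r, G) to be a sync-pair, for any choice of r. -/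
/-- The jump relation on pairs of states: agent `i` fires in state `a`, which becomes `b`. -/
def FiresTo {N : ℕ} (E : Fin N → Fin N → Prop) (r a b : Fin N → ℝ) (i : Fin N) : Prop :=
  a i = 1 ∧ b i = 0 ∧ ∀ j, j ≠ i →
    (E i j → (a j < r j → b j = 0) ∧ (r j < a j → b j = 1) ∧ (a j = r j → b j = 0 ∨ b j = 1)) ∧
    (¬ E i j → b j = a j)

/-- A finite cycle of states, joined by flows of duration `d i > 0` and by jumps of duration
`d i = 0`, unrolls to a complete execution through the states of the cycle. -/
theorem exists_complete_execution_of_cycle {N p : ℕ} [NeZero p] {E : Fin N → Fin N → Prop} {T : ℝ}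
    {r : Fin N → ℝ} (u : Fin p → Fin N → ℝ) (d : Fin p → ℝ)
    (hu : ∀ i j, u i j ∈ Set.Icc (0 : ℝ) 1)
    (hstep : ∀ i, (0 < d i ∧ ∀ j, u (i + 1) j = u i j + d i / T) ∨
      (d i = 0 ∧ ∃ a, FiresTo E r (u i) (u (i + 1)) a))
    (hd : 0 < ∑ i, d i) :
    ∃ (t : ℕ → ℝ) (x : ℕ → Fin N → ℝ),
      IsExecution E T r t x ∧ Complete t ∧ ∀ k, ∃ i, x k = u i := by
  set t : ℕ → ℝ := fun k => ∑ n ∈ Finset.range k, d (Fin.ofNat p n) with ht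
  have htsucc (k : ℕ) : t (k + 1) = t k + d (Fin.ofNat p k) := Finset.sum_range_succ _ _
  have hcast (k : ℕ) : Fin.ofNat p (k + 1) = Fin.ofNat p k + 1 := by
    apply Fin.ext
    simp [Fin.val_add]
  have hperiod (m : ℕ) : t (p * m) = m * ∑ i, d i := by
    induction m with
    | zero => simp [ht]
    | succ m ih =>
      have hsum : ∑ n ∈ Finset.range p, d (Fin.ofNat p (p * m + n)) = ∑ i, d i := by
        rw [Finset.sum_range]
        refine Finset.sum_congr rfl fun i _ => congrArg d (Fin.ext ?_)
        simp [Nat.mod_eq_of_lt i.isLt]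
      have hsplit : t (p * m + p) = t (p * m) + _ := Finset.sum_range_add _ _ _
      rw [Nat.mul_succ, hsplit, hsum, ih]
      push_cast
      ring
  refine ⟨t, fun k => u (Fin.ofNat p k), ⟨by simp [ht], fun k j => hu _ j, fun k => ?_⟩,
    fun M => ?_, fun k => ⟨_, rfl⟩⟩
  · rcases hstep (Fin.ofNat p k) with ⟨hpos, hflow⟩ | ⟨hzero, a, ha⟩
    · refine Or.inl ⟨by rw [htsucc]; linarith, fun j => ?_⟩
      simp only [hcast, hflow, htsucc, add_sub_cancel_left]
    · refine Or.inr ⟨a, by rw [htsucc, hzero, add_zero], ?_⟩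
      simpa only [hcast, FiresTo] using ha
  · obtain ⟨m, hm⟩ := exists_nat_gt (M / ∑ i, d i)
    exact ⟨p * m, by rw [hperiod]; exact (div_lt_iff₀ hd).mp hm⟩

theorem not_syncSet_of_mem_Ioo {N : ℕ} {x : Fin N → ℝ} {i j : Fin N}
    (hi : x i ∈ Set.Ioo (0 : ℝ) 1) (hij : x i ≠ x j) : ¬ SyncSet x := by
  rintro (h | h)
  · exact hij (h i j)
  · rcases h i with h | h
    · exact hi.1.ne' h
    · exact hi.2.ne h

/-- on the rooted digraph with edges `(1,2), (2,3), (3,2)`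
(vertices `0,1,2` here), for every partition vector `r ∈ (0,1]^3` there is a
complete execution that never synchronizes: rootedness is not sufficient. -/
theorem pco_rooted_not_sufficient
    (T : ℝ) (hT : 0 < T)
    (E : Fin 3 → Fin 3 → Prop)
    (hE : ∀ i j, E i j ↔ ((i, j) = ((0 : Fin 3), (1 : Fin 3)) ∨
      (i, j) = ((1 : Fin 3), (2 : Fin 3)) ∨ (i, j) = ((2 : Fin 3), (1 : Fin 3))))
    (r : Fin 3 → ℝ) (hr : ∀ i, r i ∈ Set.Ioc (0 : ℝ) 1) :
    ∃ (t : ℕ → ℝ) (x : ℕ → Fin 3 → ℝ),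
      IsExecution E T r t x ∧ Complete t ∧ ∀ k, ¬ SyncSet (x k) := by
  have hr1 := hr 1
  have hr2 := hr 2
  rcases le_or_gt (1 / 2) (r 1) with h | h
  · obtain ⟨t, x, hx, hc, hmem⟩ := exists_complete_execution_of_cycle (E := E) (T := T) (r := r)
      ![![0, 0, 1 / 2], ![1 / 2, 1 / 2, 1], ![1 / 2, 0, 0], ![1, 1 / 2, 1 / 2]]
      ![T / 2, 0, T / 2, 0]
      (by intro i j; fin_cases i <;> fin_cases j <;> norm_num)
      (by
        have hdiv : T / 2 / T = 1 / 2 := by field_simp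
        intro i
        fin_cases i
        · refine Or.inl ⟨by simpa using hT, fun j => ?_⟩
          fin_cases j <;> simp [hdiv]; norm_num
        · refine Or.inr ⟨rfl, 2, ?_⟩
          simp [FiresTo, Fin.forall_fin_succ, hE]
          grind
        · refine Or.inl ⟨by simpa using hT, fun j => ?_⟩
          fin_cases j <;> simp [hdiv]; norm_num
        · refine Or.inr ⟨rfl, 0, ?_⟩
          simp [FiresTo, Fin.forall_fin_succ, hE]
          grind)
      (by simp [Fin.sum_univ_succ]; linarith)
    refine ⟨t, x, hx, hc, fun k => ?_⟩
    obtain ⟨i, hi⟩ := hmem k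
    rw [hi]
    fin_cases i
    · exact not_syncSet_of_mem_Ioo (i := 2) (j := 0) ⟨half_pos one_pos, one_half_lt_one⟩ (by simp)
    · exact not_syncSet_of_mem_Ioo (i := 0) (j := 2) ⟨half_pos one_pos, one_half_lt_one⟩ (by simp)
    · exact not_syncSet_of_mem_Ioo (i := 0) (j := 2) ⟨half_pos one_pos, one_half_lt_one⟩ (by simp)
    · exact not_syncSet_of_mem_Ioo (i := 2) (j := 0) ⟨half_pos one_pos, one_half_lt_one⟩ (by simp)
  · obtain ⟨c, hc0, hcr⟩ := exists_between hr1.1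
    obtain ⟨t, x, hx, hc, hmem⟩ := exists_complete_execution_of_cycle (E := E) (T := T) (r := r)
      ![![0, 0, c], ![1 - c, 1 - c, 1], ![1 - c, 1, 0], ![1 - c, 0, 0], ![1, c, c]]
      ![(1 - c) * T, 0, 0, c * T, 0]
      (by
        intro i j
        fin_cases i <;> fin_cases j <;> simp <;> constructor <;> linarith)
      (by
        intro i
        fin_cases i
        · refine Or.inl ⟨mul_pos (by linarith) hT, fun j => ?_⟩
          fin_cases j <;> simp [hT.ne']
        · refine Or.inr ⟨rfl, 2, ?_⟩
          simp [FiresTo, Fin.forall_fin_succ, hE]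
          grind
        · refine Or.inr ⟨rfl, 1, ?_⟩
          simp [FiresTo, Fin.forall_fin_succ, hE]
          grind
        · refine Or.inl ⟨mul_pos hc0 hT, fun j => ?_⟩
          fin_cases j <;> simp [hT.ne']
        · refine Or.inr ⟨rfl, 0, ?_⟩
          simp [FiresTo, Fin.forall_fin_succ, hE]
          grind)
      (by simp [Fin.sum_univ_succ]; linarith)
    refine ⟨t, x, hx, hc, fun k => ?_⟩
    obtain ⟨i, hi⟩ := hmem k
    rw [hi]
    have hc1 : c < 1 := by linarith
    fin_cases i
    · exact not_syncSet_of_mem_Ioo (i := 2) (j := 0) ⟨hc0, hc1⟩ (by simpa using hc0.ne')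
    · exact not_syncSet_of_mem_Ioo (i := 0) (j := 2) (by simp [hc0, hc1]) (by simpa using hc0.ne')
    · exact not_syncSet_of_mem_Ioo (i := 0) (j := 1) (by simp [hc0, hc1]) (by simpa using hc0.ne')
    · exact not_syncSet_of_mem_Ioo (i := 0) (j := 1) (by simp [hc0, hc1])
        (by simpa [sub_eq_zero] using hc1.ne')
    · exact not_syncSet_of_mem_Ioo (i := 1) (j := 0) ⟨hc0, hc1⟩ (by simpa using hc1.ne)
end

section
/- Let G be any digraph on N vertices, T > 0, and r ∈ [0,1]^N. In any execution of the PCO network over (G, T, r), if agent i satisfies r_i > 0 and agent i resets at two steps k < k', then t_{k'} − t_k ≥ r_i · T; that is, consecutive resets of the same agent are separated in time by at least r_i T. -/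
/-- Along a single step, the phase of an agent truncated at its partition value `r i` grows
at rate at most `1 / T`. -/
theorem IsExecution.min_phase_mul_step_le {N : ℕ} {E : Fin N → Fin N → Prop} {T : ℝ}
    (hT : 0 < T) {r : Fin N → ℝ} {t : ℕ → ℝ} {x : ℕ → Fin N → ℝ}
    (hexec : IsExecution E T r t x) (i : Fin N) (m : ℕ) :
    min (r i) (x (m + 1) i) * T ≤ min (r i) (x m i) * T + (t (m + 1) - t m) := by
  obtain ⟨-, hx, hstep⟩ := hexec
  rcases hstep m with ⟨hlt, hflow⟩ | ⟨j, ht, hj, hj', hothers⟩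
  · have hd : 0 < (t (m + 1) - t m) / T := div_pos (sub_pos.2 hlt) hT
    have hmin : min (r i) (x (m + 1) i) ≤ min (r i) (x m i) + (t (m + 1) - t m) / T := by
      rw [hflow i, ← min_add_add_right]
      exact min_le_min_right _ (by linarith)
    calc min (r i) (x (m + 1) i) * T
        ≤ (min (r i) (x m i) + (t (m + 1) - t m) / T) * T :=
          mul_le_mul_of_nonneg_right hmin hT.le
      _ = min (r i) (x m i) * T + (t (m + 1) - t m) := by
          rw [add_mul, div_mul_cancel₀ _ hT.ne']
  · rw [ht, sub_self, add_zero]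
    refine mul_le_mul_of_nonneg_right ?_ hT.le
    rcases le_or_gt (r i) (x m i) with hle | hlt
    · rw [min_eq_left hle]
      exact min_le_left _ _
    · refine min_le_min_left _ ?_
      have h0 := (hx m i).1
      by_cases hij : i = j
      · subst hij
        linarith
      · by_cases hE : E j i
        · rw [((hothers i hij).1 hE).1 hlt]
          exact h0
        · exact ((hothers i hij).2 hE).le

/-- Over any stretch of an execution, the phase of an agent truncated at its partition value
`r i` grows at rate at most `1 / T`. -/
theorem IsExecution.min_phase_mul_le {N : ℕ} {E : Fin N → Fin N → Prop} {T : ℝ}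
    (hT : 0 < T) {r : Fin N → ℝ} {t : ℕ → ℝ} {x : ℕ → Fin N → ℝ}
    (hexec : IsExecution E T r t x) (i : Fin N) {l m : ℕ} (hlm : l ≤ m) :
    min (r i) (x m i) * T ≤ min (r i) (x l i) * T + (t m - t l) := by
  induction m, hlm using Nat.le_induction with
  | base => simp
  | succ m _ ih => linarith [hexec.min_phase_mul_step_le hT i m]

/-- in any execution, two resets of the same agent `i` with
`r_i > 0` are separated in time by at least `r_i · T`. -/
theorem pco_reset_dwell_time
    {N : ℕ} (E : Fin N → Fin N → Prop)
    (hsimple : ∀ i, ¬ E i i)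
    (T : ℝ) (hT : 0 < T)
    (r : Fin N → ℝ) (hr01 : ∀ i, r i ∈ Set.Icc (0 : ℝ) 1)
    (t : ℕ → ℝ) (x : ℕ → Fin N → ℝ)
    (hexec : IsExecution E T r t x)
    (i : Fin N) (hri : 0 < r i)
    (k k' : ℕ) (hkk' : k < k')
    (hk : JumpStepAt E r t x k i) (hk' : JumpStepAt E r t x k' i) :
    r i * T ≤ t k' - t k := by
  have h := hexec.min_phase_mul_le hT i (Nat.succ_le_of_lt hkk')
  obtain ⟨ht, -, hx, -⟩ := hk
  rw [Nat.succ_eq_add_one, ht, hx, hk'.2.1, min_eq_left (hr01 i).2, min_eq_right hri.le] at h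
  linarith
end

section
/- Let G be any digraph on N vertices, T > 0, and r ∈ (0,1]^N. Then in any execution of the PCO network over (G, T, r): (i) any run of consecutive jump steps has length at most N (so there is no purely discrete/Zeno execution); and (ii) for every a ∈ ℝ, the number of jump steps k with t_k ∈ [a, a+T) is at most Σ_{i=1}^N ⌈1/r_i⌉ (in particular at most N·⌈1/min_i r_i⌉). -/
/-- After agent `i` fires at step `k`, its phase is bounded by the elapsed time in periods
until at least `r i * T` time units have passed. -/
lemma phase_le_elapsed_or_le_elapsed {N : ℕ} {E : Fin N → Fin N → Prop} {T : ℝ} (hT : 0 < T)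
    {r : Fin N → ℝ} {t : ℕ → ℝ} {x : ℕ → Fin N → ℝ} (hexec : IsExecution E T r t x)
    {k : ℕ} {i : Fin N} (hk : JumpStepAt E r t x k i) (m : ℕ) :
    t k ≤ t (k + 1 + m) ∧
      (x (k + 1 + m) i ≤ (t (k + 1 + m) - t k) / T ∨ r i * T ≤ t (k + 1 + m) - t k) := by
  induction m with
  | zero =>
    obtain ⟨ht, -, hx, -⟩ := hk
    simp [ht, hx]
  | succ m ih =>
    obtain ⟨hle, h⟩ := ih
    rw [← add_assoc]
    generalize k + 1 + m = n at *
    rcases hexec.2.2 n with ⟨hlt, hflow⟩ | ⟨j, ht, -, hzero, hjump⟩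
    · refine ⟨by linarith, ?_⟩
      rcases h with h | h
      · left
        have : (t (n + 1) - t k) / T = (t n - t k) / T + (t (n + 1) - t n) / T := by ring
        rw [hflow i, this]
        linarith
      · right
        linarith
    · rw [ht]
      refine ⟨hle, ?_⟩
      rcases h with h | h
      · have hnonneg : 0 ≤ (t n - t k) / T := div_nonneg (by linarith) hT.le
        by_cases hij : i = j
        · subst hij
          left
          rwa [hzero]
        · by_cases hE : E j i
          · rcases lt_or_ge (x n i) (r i) with hlt | hge
            · left
              rwa [((hjump i hij).1 hE).1 hlt]
            · right
              exact (le_div_iff₀ hT).1 (hge.trans h)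
          · left
            rwa [(hjump i hij).2 hE]
      · exact Or.inr h

/-- Two firings of agent `i` are separated by at least `r i * T` time units. -/
lemma le_sub_of_jumpStepAt {N : ℕ} {E : Fin N → Fin N → Prop} {T : ℝ} (hT : 0 < T)
    {r : Fin N → ℝ} {t : ℕ → ℝ} {x : ℕ → Fin N → ℝ} (hexec : IsExecution E T r t x)
    {k l : ℕ} {i : Fin N} (hr : r i ≤ 1) (hkl : k < l)
    (hk : JumpStepAt E r t x k i) (hl : JumpStepAt E r t x l i) :
    r i * T ≤ t l - t k := by
  obtain ⟨m, rfl⟩ := Nat.exists_eq_add_of_le (Nat.succ_le_of_lt hkl)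
  rcases (phase_le_elapsed_or_le_elapsed hT hexec hk m).2 with h | h
  · rw [hl.2.1] at h
    exact (le_div_iff₀ hT).1 (hr.trans h)
  · exact h

/-- A set of indices whose times lie in `[a, a + T)` and are pairwise separated by `ρ * T`
has at most `⌈1 / ρ⌉₊` elements. -/
lemma card_le_ceil_of_separated {T a ρ : ℝ} (hT : 0 < T) (hρ : 0 < ρ) {t : ℕ → ℝ}
    {S : Finset ℕ} (hS : ∀ k ∈ S, t k ∈ Set.Ico a (a + T))
    (hsep : ∀ k ∈ S, ∀ l ∈ S, k < l → ρ * T ≤ t l - t k) :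
    S.card ≤ ⌈1 / ρ⌉₊ := by
  have hd : 0 < ρ * T := mul_pos hρ hT
  have hnonneg : ∀ k ∈ S, 0 ≤ (t k - a) / (ρ * T) := fun k hk =>
    div_nonneg (sub_nonneg.2 (hS k hk).1) hd.le
  have hfloor : ∀ k ∈ S, ∀ l ∈ S, k < l →
      ⌊(t k - a) / (ρ * T)⌋₊ < ⌊(t l - a) / (ρ * T)⌋₊ := by
    intro k hk l hl hkl
    rw [← Nat.succ_le_iff, Nat.succ_eq_add_one, ← Nat.floor_add_one (hnonneg k hk)]
    apply Nat.floor_le_floor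
    rw [div_add_one hd.ne', div_le_div_iff_of_pos_right hd]
    linarith [hsep k hk l hl hkl]
  rw [← Finset.card_range ⌈1 / ρ⌉₊]
  apply Finset.card_le_card_of_injOn (fun k => ⌊(t k - a) / (ρ * T)⌋₊)
  · intro k hk
    simp only [Finset.coe_range, Set.mem_Iio]
    rw [Nat.floor_lt (hnonneg k hk)]
    refine lt_of_lt_of_le ?_ (Nat.le_ceil _)
    rw [div_lt_div_iff₀ hd hρ]
    nlinarith [(hS k hk).2]
  · intro k hk l hl h
    rcases lt_trichotomy k l with hkl | hkl | hkl
    · exact absurd h (hfloor k hk l hl hkl).ne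
    · exact hkl
    · exact absurd h (hfloor l hl k hk hkl).ne'

/-- with `r ∈ (0,1]^N`, (i) there are never `N + 1` consecutive
jump steps (no purely discrete/Zeno execution), and (ii) any time window
`[a, a + T)` contains at most `∑ i, ⌈1 / r_i⌉` jump steps. -/
theorem pco_non_zeno_and_jump_bound
    {N : ℕ} (E : Fin N → Fin N → Prop)
    (hsimple : ∀ i, ¬ E i i)
    (T : ℝ) (hT : 0 < T)
    (r : Fin N → ℝ) (hr : ∀ i, r i ∈ Set.Ioc (0 : ℝ) 1)
    (t : ℕ → ℝ) (x : ℕ → Fin N → ℝ)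
    (hexec : IsExecution E T r t x) :
    (∀ k : ℕ, ¬ ∀ m ≤ N, JumpStep E r t x (k + m)) ∧
    (∀ a : ℝ, ∀ S : Finset ℕ,
      (∀ k ∈ S, JumpStep E r t x k ∧ t k ∈ Set.Ico a (a + T)) →
      S.card ≤ ∑ i : Fin N, ⌈1 / r i⌉₊) := by
 
  refine ⟨fun k hjump => ?_, fun a S hS => ?_⟩
  · have ht : ∀ m ≤ N, t (k + m) = t k := by
      intro m
      induction m with
      | zero => simp
      | succ m ih =>
        intro hm
        obtain ⟨i, hi⟩ := hjump m (by omega)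
        exact hi.1.trans (ih (by omega))
    choose f hf using fun m : Fin (N + 1) => hjump m (Nat.lt_succ_iff.1 m.2)
    have hlt : ∀ m n : Fin (N + 1), m < n → f m ≠ f n := by
      intro m n hmn hfmn
      have hsep := le_sub_of_jumpStepAt hT hexec (hr (f m)).2
        (Nat.add_lt_add_left hmn k) (hf m) (hfmn ▸ hf n)
      rw [ht m (Nat.lt_succ_iff.1 m.2), ht n (Nat.lt_succ_iff.1 n.2), sub_self] at hsep
      exact hsep.not_gt (mul_pos (hr (f m)).1 hT)
    obtain ⟨m, n, hmn, hfmn⟩ := Fintype.exists_ne_map_eq_of_card_lt f (by simp)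
    rcases lt_or_gt_of_ne hmn with h | h
    · exact hlt m n h hfmn
    · exact hlt n m h hfmn.symm
  · classical
    refine (Finset.card_le_card (t := Finset.univ.biUnion fun i =>
      S.filter fun k => JumpStepAt E r t x k i) fun k hk => ?_).trans
      (Finset.card_biUnion_le.trans (Finset.sum_le_sum fun i _ => ?_))
    · obtain ⟨i, hi⟩ := (hS k hk).1
      simp only [Finset.mem_biUnion, Finset.mem_univ, true_and, Finset.mem_filter]
      exact ⟨i, hk, hi⟩
    · refine card_le_ceil_of_separated (a := a) (t := t) hT (hr i).1
        (fun k hk => (hS k (Finset.mem_filter.1 hk).1).2) fun k hk l hl hkl => ?_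
      exact le_sub_of_jumpStepAt hT hexec (hr i).2 hkl
        (Finset.mem_filter.1 hk).2 (Finset.mem_filter.1 hl).2
end

section
/- Let G be a rooted digraph on N vertices, T > 0, and r ∈ [0,1]^N arbitrary. Then in every complete execution of the PCO network over (G, T, r), from every initial state, there exist a step k with t_k ≤ T and a root i* of G such that x_{k,i*} = 1; that is, some root of the network attains phase 1 (fires) within one period T. -/
theorem IsRoot.of_edge {V : Type*} {E : V → V → Prop} {i j : V} (hj : IsRoot E j)
    (h : E i j) : IsRoot E i :=
  fun l => (hj l).head h

/-- An agent that is neither firing nor a target of the firing agent keeps its phase. -/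
theorem JumpStepAt.eq_of_not_edge {N : ℕ} {E : Fin N → Fin N → Prop} {r : Fin N → ℝ}
    {t : ℕ → ℝ} {x : ℕ → Fin N → ℝ} {k : ℕ} {i j : Fin N} (h : JumpStepAt E r t x k i)
    (hji : j ≠ i) (hE : ¬ E i j) : x (k + 1) j = x k j :=
  (h.2.2.2 j hji).2 hE

/-- over a rooted digraph, in every complete execution some root
attains phase `1` within one period `T`. -/
theorem pco_root_fires_within_period
    {N : ℕ} (E : Fin N → Fin N → Prop)
    (hsimple : ∀ i, ¬ E i i)
    (hrooted : ∃ i, IsRoot E i)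
    (T : ℝ) (hT : 0 < T)
    (r : Fin N → ℝ) (hr : ∀ i, r i ∈ Set.Icc (0 : ℝ) 1)
    (t : ℕ → ℝ) (x : ℕ → Fin N → ℝ)
    (hexec : IsExecution E T r t x) (hcomp : Complete t) :
    ∃ (k : ℕ) (istar : Fin N), t k ≤ T ∧ IsRoot E istar ∧ x k istar = 1 := by
  obtain ⟨ht0, hx, hstep⟩ := hexec
  obtain ⟨i₀, hi₀⟩ := hrooted
  by_contra! hno
  have phase_eq : ∀ k, x k i₀ = x 0 i₀ + t k / T ∧ t k ≤ T := by
    intro k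
    induction k with
    | zero => simp [ht0, hT.le]
    | succ k ih =>
      obtain ⟨ih, hk⟩ := ih
      rcases hstep k with ⟨-, hflow⟩ | ⟨i, hjump⟩
      · have heq : x (k + 1) i₀ = x 0 i₀ + t (k + 1) / T := by
          rw [hflow, ih]
          ring
        refine ⟨heq, (div_le_one hT).1 ?_⟩
        linarith [(hx 0 i₀).1, (hx (k + 1) i₀).2]
      · have hi : ¬ IsRoot E i := fun hi => hno k i hk hi hjump.2.1
        have hne : i₀ ≠ i := fun h => hi (h ▸ hi₀)
        rw [hjump.eq_of_not_edge hne fun h => hi (hi₀.of_edge h), hjump.1]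
        exact ⟨ih, hk⟩
  obtain ⟨k, hk⟩ := hcomp T
  exact hk.not_ge (phase_eq k).2
end
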